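/- Let N ≥ 1, t > 0, and let z ∈ ℝ^N be the strictly increasing vector of the N roots of the physicist's Hermite polynomial H_N. Then for every permutation ρ ∈ S_N, F_N(√(2t)·ρz, t) = 0. -/

import Mathlib

/-- Physicist's Hermite polynomials: `H 0 = 1`, `H 1 = 2x`,
`H (n+2) = 2x * H (n+1) - 2(n+1) * H n`. -/
noncomputable def physHermite : ℕ → Polynomial ℝ
  | 0 => 1
  | 1 => Polynomial.C 2 * Polynomial.X
  | (n + 2) => Polynomial.C 2 * Polynomial.X * physHermite (n + 1)
      - Polynomial.C (2 * ((n : ℝ) + 1)) * physHermite n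

/-- The function
`F_N(v,t) = (N/2)(N−1)(1 − log t) − ∑_{j=1}^N j log j + 2 log|h_N(v)| − |v|²/(2t)`,
where `h_N(v) = ∏_{i<j} (v_j − v_i)` is the Vandermonde determinant. -/
noncomputable def FN (N : ℕ) (v : Fin N → ℝ) (t : ℝ) : ℝ :=
  ((N : ℝ) / 2) * ((N : ℝ) - 1) * (1 - Real.log t)
    - ∑ j ∈ Finset.Icc 1 N, (j : ℝ) * Real.log j
    + 2 * Real.log |∏ i : Fin N, ∏ j ∈ Finset.Ioi i, (v j - v i)|
    - (∑ i, v i ^ 2) / (2 * t)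

open Polynomial Finset

theorem physHermite_add_two (n : ℕ) :
    physHermite (n + 2) = C 2 * X * physHermite (n + 1)
      - C (2 * ((n : ℝ) + 1)) * physHermite n := by
  rw [physHermite]

theorem natDegree_physHermite_le (n : ℕ) : (physHermite n).natDegree ≤ n := by
  induction n using Nat.twoStepInduction with
  | zero => simp [physHermite]
  | one => simp [physHermite]
  | more n h0 h1 =>
    rw [physHermite_add_two]
    refine (natDegree_sub_le _ _).trans (max_le ?_ ?_)
    · rw [mul_assoc]
      refine (natDegree_C_mul_le _ _).trans (natDegree_mul_le.trans ?_)
      rw [natDegree_X]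
      omega
    · exact (natDegree_C_mul_le _ _).trans (by omega)

/-- The three leading coefficients of `H_n`, shifted by `X ^ 2` so that they exist for all `n`. -/
theorem coeff_X_sq_mul_physHermite (n : ℕ) :
    (X ^ 2 * physHermite n).coeff (n + 2) = 2 ^ n ∧
    (X ^ 2 * physHermite n).coeff (n + 1) = 0 ∧
    4 * (X ^ 2 * physHermite n).coeff n = -((2 : ℝ) ^ n * n * (n - 1)) := by
  induction n using Nat.twoStepInduction with
  | zero => simp [physHermite, coeff_X_pow]
  | one =>
    have h : X ^ 2 * physHermite 1 = C 2 * X ^ 3 := by rw [physHermite]; ring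
    simp [h, coeff_X_pow]
  | more n h0 h1 =>
    have h : X ^ 2 * physHermite (n + 2) = C 2 * (X * (X ^ 2 * physHermite (n + 1)))
        - C (2 * ((n : ℝ) + 1)) * (X ^ 2 * physHermite n) := by
      rw [physHermite_add_two]; ring
    have hz : ∀ k, n + 2 < k → (X ^ 2 * physHermite n).coeff k = 0 := fun k hk => by
      refine coeff_eq_zero_of_natDegree_lt (lt_of_le_of_lt natDegree_mul_le ?_)
      have := natDegree_physHermite_le n
      rw [natDegree_X_pow]
      omega
    obtain ⟨a0, -, -⟩ := h0
    obtain ⟨b0, b1, b2⟩ := h1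
    rw [h]
    simp only [coeff_sub, coeff_C_mul, coeff_X_mul]
    refine ⟨?_, ?_, ?_⟩
    · rw [b0, hz _ (by omega)]; ring
    · rw [b1, hz _ (by omega)]; ring
    · rw [a0]
      push_cast at b2 ⊢
      linear_combination 2 * b2

theorem coeff_physHermite_self (n : ℕ) : (physHermite n).coeff n = 2 ^ n := by
  rw [← (coeff_X_sq_mul_physHermite n).1, coeff_X_pow_mul]

theorem natDegree_physHermite (n : ℕ) : (physHermite n).natDegree = n :=
  natDegree_eq_of_le_of_coeff_ne_zero (natDegree_physHermite_le n)
    (by rw [coeff_physHermite_self]; positivity)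

theorem leadingCoeff_physHermite (n : ℕ) : (physHermite n).leadingCoeff = 2 ^ n := by
  rw [leadingCoeff, natDegree_physHermite, coeff_physHermite_self]

theorem physHermite_ne_zero (n : ℕ) : physHermite n ≠ 0 := by
  rw [← leadingCoeff_ne_zero, leadingCoeff_physHermite]
  positivity

theorem derivative_physHermite_succ (n : ℕ) :
    derivative (physHermite (n + 1)) = C (2 * ((n : ℝ) + 1)) * physHermite n := by
  induction n using Nat.twoStepInduction with
  | zero => simp [physHermite]
  | one =>
    simp only [physHermite, derivative_sub, derivative_mul, derivative_C, derivative_X, map_mul,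
      map_add, map_natCast, map_one]
    push_cast
    simp
    ring
  | more n h0 h1 =>
    have e := physHermite_add_two n
    rw [physHermite_add_two (n + 1)]
    simp only [derivative_sub, derivative_mul, derivative_C, derivative_X, h0, h1]
    rw [show n + 1 + 1 = n + 2 from rfl, e]
    simp only [map_mul, map_add, map_natCast, map_one, Nat.cast_add, Nat.cast_one, Nat.cast_ofNat,
      map_ofNat]
    ring

theorem abs_resultant_physHermite (n : ℕ) :
    |resultant (physHermite (n + 1)) (physHermite n) (n + 1) n|
      = ∏ k ∈ Finset.Icc 1 n, (8 * (k : ℝ)) ^ k := by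
  induction n with
  | zero => simp [physHermite]
  | succ n ih =>
    have h : physHermite (n + 1 + 1) = C (-(2 * ((n : ℝ) + 1))) * physHermite n
        + physHermite (n + 1) * (C 2 * X) := by
      rw [physHermite_add_two, map_neg]; ring
    have hd : (C (2 : ℝ) * X).natDegree ≤ 1 := (natDegree_C_mul_le _ _).trans natDegree_X_le
    rw [Finset.prod_Icc_succ_top (by omega), ← ih, h,
      resultant_add_mul_left _ _ _ _ _ (by omega) (natDegree_physHermite_le _),
      resultant_C_mul_left,
      show n + 1 + 1 = n + 2 from rfl,
      resultant_add_left_deg _ _ _ _ _ (natDegree_physHermite_le _),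
      resultant_comm, coeff_physHermite_self]
    simp only [abs_mul, abs_pow, abs_neg, abs_one, one_pow, one_mul, Nat.abs_ofNat]
    have : |(n : ℝ) + 1| = n + 1 := abs_of_nonneg (by positivity)
    rw [this]
    push_cast
    rw [show (8 : ℝ) * (n + 1) = 2 * (n + 1) * 2 ^ 2 by ring, mul_pow _ ((2 : ℝ) ^ 2),
      pow_right_comm 2 2]
    ring

theorem roots_physHermite {N : ℕ} {z : Fin N → ℝ} (hz : Function.Injective z)
    (hroot : ∀ i, (physHermite N).eval (z i) = 0) :
    (physHermite N).roots = univ.val.map z := by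
  refine (Multiset.eq_of_le_of_card_le ?_ ?_).symm
  · rw [Multiset.le_iff_subset (univ.nodup.map hz)]
    intro x hx
    obtain ⟨i, -, rfl⟩ := Multiset.mem_map.mp hx
    exact (mem_roots (physHermite_ne_zero N)).mpr (hroot i)
  · simpa [natDegree_physHermite] using card_roots' (physHermite N)

theorem physHermite_eq_C_mul_nodal {N : ℕ} {z : Fin N → ℝ} (hz : Function.Injective z)
    (hroot : ∀ i, (physHermite N).eval (z i) = 0) :
    physHermite N = C (2 ^ N) * Lagrange.nodal univ z := by
  have h := roots_physHermite hz hroot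
  have := C_leadingCoeff_mul_prod_multiset_X_sub_C (p := physHermite N)
    (by simp [h, natDegree_physHermite])
  rw [← this, leadingCoeff_physHermite, h, Multiset.map_map]
  rfl

/-- The leading coefficients of a nodal polynomial determine the power sums of its nodes. -/
theorem coeff_X_sq_mul_nodal {ι R : Type*} [CommRing R] (s : Finset ι) (z : ι → R) :
    (X ^ 2 * Lagrange.nodal s z).coeff (#s + 2) = 1 ∧
    (X ^ 2 * Lagrange.nodal s z).coeff (#s + 1) = -∑ i ∈ s, z i ∧
    2 * (X ^ 2 * Lagrange.nodal s z).coeff #s = (∑ i ∈ s, z i) ^ 2 - ∑ i ∈ s, z i ^ 2 := by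
  classical
  induction s using Finset.induction_on with
  | empty => simp [coeff_X_pow]
  | insert a s ha ih =>
    obtain ⟨h0, h1, h2⟩ := ih
    have hdeg : (X ^ 2 * Lagrange.nodal s z).coeff (#s + 3) = 0 := by
      nontriviality R
      refine coeff_eq_zero_of_natDegree_lt (lt_of_le_of_lt natDegree_mul_le ?_)
      rw [natDegree_X_pow, Lagrange.natDegree_nodal]
      omega
    have h : X ^ 2 * Lagrange.nodal (insert a s) z
        = X * (X ^ 2 * Lagrange.nodal s z) - C (z a) * (X ^ 2 * Lagrange.nodal s z) := by
      rw [Lagrange.nodal_insert_eq_nodal ha]; ring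
    rw [h, card_insert_of_notMem ha, sum_insert ha, sum_insert ha]
    simp only [coeff_sub, coeff_C_mul, coeff_X_mul]
    refine ⟨?_, ?_, ?_⟩
    · rw [h0, show #s + 1 + 2 = #s + 3 from rfl, hdeg]; ring
    · rw [h1, h0]; ring
    · rw [h1]
      linear_combination h2

theorem sum_sq_roots_physHermite {N : ℕ} {z : Fin N → ℝ} (hz : Function.Injective z)
    (hroot : ∀ i, (physHermite N).eval (z i) = 0) :
    ∑ i, z i ^ 2 = N * (N - 1) / 2 := by
  obtain ⟨-, h1, h2⟩ := coeff_X_sq_mul_physHermite N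
  obtain ⟨-, g1, g2⟩ := coeff_X_sq_mul_nodal univ z
  rw [physHermite_eq_C_mul_nodal hz hroot, mul_left_comm, coeff_C_mul] at h1 h2
  rw [card_univ, Fintype.card_fin] at g1 g2
  have hp : (2 : ℝ) ^ N ≠ 0 := by positivity
  have hs : ∑ i, z i = 0 := by
    rw [g1] at h1
    simpa [hp] using h1
  rw [hs] at g2
  have : (2 : ℝ) ^ N * (4 * (X ^ 2 * Lagrange.nodal univ z).coeff N) = 2 ^ N * -(N * (N - 1)) := by
    linear_combination h2
  linear_combination g2 - (1 / 2) * mul_left_cancel₀ hp this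

theorem sq_prod_Ioi_sub {N : ℕ} (v : Fin N → ℝ) :
    (∏ i : Fin N, ∏ j ∈ Finset.Ioi i, (v j - v i)) ^ 2
      = ∏ i, ∏ j ∈ univ.erase i, |v i - v j| := by
  have h := prod_prod_Ioi_mul_eq_prod_prod_off_diag (fun i j => |v i - v j|)
  rw [← sq_abs, sq, abs_prod, ← prod_mul_distrib]
  simp only [abs_prod, ← prod_mul_distrib]
  refine (prod_congr rfl fun i _ => prod_congr rfl fun j _ => ?_).trans
    (h.trans (prod_congr rfl fun i _ => prod_congr (by ext; simp) fun j _ => abs_sub_comm _ _))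
  rw [abs_sub_comm (v i) (v j)]

theorem discr_physHermite {n : ℕ} {z : Fin (n + 1) → ℝ} (hz : Function.Injective z)
    (hroot : ∀ i, (physHermite (n + 1)).eval (z i) = 0) :
    (2 ^ (n + 1)) ^ n * (2 ^ (n + 1)) ^ (n + 1) *
        (∏ i : Fin (n + 1), ∏ j ∈ Finset.Ioi i, (z j - z i)) ^ 2
      = (2 * ((n : ℝ) + 1)) ^ (n + 1) * ∏ k ∈ Finset.Icc 1 n, (8 * (k : ℝ)) ^ k := by
  have hnode := physHermite_eq_C_mul_nodal hz hroot
  have hroots := roots_physHermite hz hroot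
  have hR := resultant_eq_prod_eval (physHermite (n + 1)) (physHermite n) n
    (natDegree_physHermite_le n)
    (splits_iff_card_roots.mpr
      (by simp [hroots, natDegree_physHermite]))
  rw [natDegree_physHermite, leadingCoeff_physHermite, hroots, Multiset.map_map] at hR
  have hR' : resultant (physHermite (n + 1)) (physHermite n) (n + 1) n
      = (2 ^ (n + 1)) ^ n * ∏ i, (physHermite n).eval (z i) := hR
  have hi : ∀ i, 2 * ((n : ℝ) + 1) * |(physHermite n).eval (z i)|
      = 2 ^ (n + 1) * ∏ j ∈ univ.erase i, |z i - z j| := fun i => by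
    have h := congrArg (fun p => |(derivative p).eval (z i)|) hnode
    simp only [derivative_physHermite_succ, derivative_C_mul, eval_C_mul,
      Lagrange.eval_nodal_derivative_eval_node_eq (mem_univ i), Lagrange.eval_nodal, abs_mul,
      abs_prod, abs_pow] at h
    simpa [abs_of_nonneg (show (0 : ℝ) ≤ n + 1 by positivity)] using h
  have hprod := prod_congr (rfl : (univ : Finset (Fin (n + 1))) = univ) fun i _ => hi i
  simp only [prod_mul_distrib, prod_const, card_univ, Fintype.card_fin] at hprod
  rw [sq_prod_Ioi_sub, ← abs_resultant_physHermite, hR', abs_mul, abs_prod, abs_pow, abs_pow,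
    Nat.abs_ofNat, mul_assoc, ← hprod, mul_pow]
  ring

theorem two_mul_log_abs_prod_Ioi {n : ℕ} {z : Fin (n + 1) → ℝ} (hz : Function.Injective z)
    (hroot : ∀ i, (physHermite (n + 1)).eval (z i) = 0) :
    2 * Real.log |∏ i : Fin (n + 1), ∏ j ∈ Finset.Ioi i, (z j - z i)|
      = ∑ j ∈ Finset.Icc 1 (n + 1), (j : ℝ) * Real.log j - (n + 1) * n / 2 * Real.log 2 := by
  have hV : (∏ i : Fin (n + 1), ∏ j ∈ Finset.Ioi i, (z j - z i)) ≠ 0 :=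
    prod_ne_zero_iff.mpr fun i _ => prod_ne_zero_iff.mpr fun j hj =>
      sub_ne_zero.mpr (hz.ne (mem_Ioi.mp hj).ne')
  have hk : ∀ k ∈ Finset.Icc 1 n, (8 * (k : ℝ)) ^ k ≠ 0 := fun k hk => by
    have : 0 < k := (mem_Icc.mp hk).1
    positivity
  have hsum : ∑ k ∈ Finset.Icc 1 n, (k : ℝ) = n * (n + 1) / 2 := by
    clear * -
    induction n with
    | zero => simp
    | succ n ih => rw [sum_Icc_succ_top (by omega), ih]; push_cast; ring
  have h8 : Real.log 8 = 3 * Real.log 2 := by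
    rw [show (8 : ℝ) = 2 ^ 3 by norm_num, Real.log_pow]; norm_num
  have hlog : ∑ k ∈ Finset.Icc 1 n, Real.log ((8 * (k : ℝ)) ^ k)
      = 3 * Real.log 2 * (n * (n + 1) / 2) + ∑ k ∈ Finset.Icc 1 n, (k : ℝ) * Real.log k := by
    rw [← hsum, mul_sum, ← sum_add_distrib]
    refine sum_congr rfl fun k hk => ?_
    have : (k : ℝ) ≠ 0 := by have := (mem_Icc.mp hk).1; positivity
    rw [Real.log_pow, Real.log_mul (by norm_num) this, h8]
    ring
  have h := congrArg Real.log (discr_physHermite hz hroot)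
  rw [Real.log_mul (by positivity) (by positivity), Real.log_mul (by positivity) (by positivity),
    Real.log_mul (by positivity) (prod_ne_zero_iff.mpr hk), Real.log_prod hk, hlog] at h
  simp only [Real.log_pow] at h
  rw [Real.log_mul (by norm_num) (by positivity)] at h
  rw [Real.log_abs, sum_Icc_succ_top (by omega)]
  push_cast at h ⊢
  linear_combination h

theorem prod_Ioi_const_mul_sub_sq {n : ℕ} (v : Fin (n + 1) → ℝ) {c : ℝ} (hc : 0 ≤ c) :
    (∏ i : Fin (n + 1), ∏ j ∈ Finset.Ioi i, (c * v j - c * v i)) ^ 2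
      = (c ^ 2) ^ (n * (n + 1) / 2) * (∏ i : Fin (n + 1), ∏ j ∈ Finset.Ioi i, (v j - v i)) ^ 2 := by
  rw [← pow_mul, Nat.mul_div_cancel' (Nat.even_mul_succ_self n).two_dvd, sq_prod_Ioi_sub,
    sq_prod_Ioi_sub]
  simp only [← mul_sub, abs_mul, abs_of_nonneg hc, prod_mul_distrib, prod_const, mem_univ,
    card_erase_of_mem, card_univ, Fintype.card_fin, Nat.add_sub_cancel, pow_mul]

theorem FN_sqrt_mul_eq_zero {n : ℕ} {t : ℝ} (ht : 0 < t) {z : Fin (n + 1) → ℝ}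
    (hz : Function.Injective z) (hroot : ∀ i, (physHermite (n + 1)).eval (z i) = 0) :
    FN (n + 1) (fun j => Real.sqrt (2 * t) * z j) t = 0 := by
  have hV : (∏ i : Fin (n + 1), ∏ j ∈ Finset.Ioi i, (z j - z i)) ≠ 0 :=
    prod_ne_zero_iff.mpr fun i _ => prod_ne_zero_iff.mpr fun j hj =>
      sub_ne_zero.mpr (hz.ne (mem_Ioi.mp hj).ne')
  have hc : Real.sqrt (2 * t) ^ 2 = 2 * t := Real.sq_sqrt (by positivity)
  have hsq : ∑ i, (Real.sqrt (2 * t) * z i) ^ 2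
      = 2 * t * (((n + 1 : ℕ) : ℝ) * ((n + 1 : ℕ) - 1) / 2) := by
    rw [← sum_sq_roots_physHermite hz hroot, mul_sum]
    simp only [mul_pow, hc]
  have hlog := congrArg Real.log (prod_Ioi_const_mul_sub_sq z (Real.sqrt_nonneg (2 * t)))
  rw [hc, Real.log_mul (by positivity) (by positivity), Real.log_pow, Real.log_pow, Real.log_pow,
    Real.log_mul (by norm_num) ht.ne', Nat.cast_div (Nat.even_mul_succ_self n).two_dvd (by norm_num)]
    at hlog
  have h := two_mul_log_abs_prod_Ioi hz hroot
  rw [Real.log_abs] at h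
  rw [FN, hsq, mul_div_cancel_left₀ _ (by positivity), Real.log_abs]
  push_cast at hlog ⊢
  linear_combination hlog + h

/-- If `z` is the increasing vector of roots of `H_N`, then for every permutation
`ρ` one has `F_N(√(2t)·ρz, t) = 0`. -/
theorem stmt_11 (N : ℕ) (hN : 1 ≤ N) (t : ℝ) (ht : 0 < t)
    (z : Fin N → ℝ) (hz : StrictMono z)
    (hroot : ∀ i, (physHermite N).eval (z i) = 0) :
    ∀ ρ : Equiv.Perm (Fin N), FN N (fun j => Real.sqrt (2 * t) * z (ρ j)) t = 0 := by
  obtain ⟨n, rfl⟩ := Nat.exists_eq_add_of_le' hN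
  exact fun ρ => FN_sqrt_mul_eq_zero (z := fun j => z (ρ j)) ht
    (hz.injective.comp ρ.injective) fun i => hroot (ρ i)
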